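/- Fix an integer N ≥ 2. For all real numbers I and J, the inequality |I|^{1/N} + |J|^{1/N} ≤ 1 holds if and only if at least one of the following holds: there exist q₁, …, q_{N−1} ∈ (0,1) with |I|/(q₁⋯q_{N−1}) + |J|/((1−q₁)⋯(1−q_{N−1})) ≤ 1; or J = 0 and |I| ≤ 1; or I = 0 and |J| ≤ 1. -/

import Mathlib

/-- AM-GM applied to `x / ∏ j, q j` together with the `q j`. -/
theorem rpow_inv_succ_le_of_pos {n : ℕ} {x : ℝ} (hx : 0 ≤ x) {q : Fin n → ℝ}
    (hq : ∀ j, 0 < q j) :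
    x ^ ((1 : ℝ) / ((n + 1 : ℕ) : ℝ)) ≤ (x / ∏ j, q j + ∑ j, q j) / ((n + 1 : ℕ) : ℝ) := by
  have hP : 0 < ∏ j, q j := Finset.prod_pos fun j _ => hq j
  have hz : ∀ i, 0 ≤ (Fin.cons (x / ∏ j, q j) q : Fin (n + 1) → ℝ) i :=
    Fin.cases (div_nonneg hx hP.le) fun j => (hq j).le
  have h := Real.geom_mean_le_arith_mean_weighted Finset.univ
    (fun _ : Fin (n + 1) => (1 : ℝ) / ((n + 1 : ℕ) : ℝ)) (Fin.cons (x / ∏ j, q j) q)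
    (fun _ _ => by positivity) (by simp; field_simp) (fun i _ => hz i)
  rw [Real.finsetProd_rpow _ _ (fun i _ => hz i), ← Finset.mul_sum, Fin.prod_univ_succ,
    Fin.sum_univ_succ] at h
  simp only [Fin.cons_zero, Fin.cons_succ, div_mul_cancel₀ _ hP.ne'] at h
  rwa [one_div_mul_eq_div] at h

/-- For `a, b > 0` with `a + b ≤ 1`, the constant choice `q = a / (a + b)` is admissible. -/
theorem pow_succ_div_add_pow_succ_div_le_one {a b : ℝ} (ha : 0 < a) (hb : 0 < b)
    (hab : a + b ≤ 1) (n : ℕ) :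
    a ^ (n + 1) / (a / (a + b)) ^ n + b ^ (n + 1) / (1 - a / (a + b)) ^ n ≤ 1 := by
  have hs : 0 < a + b := by positivity
  have h1 : 1 - a / (a + b) = b / (a + b) := by field_simp; ring
  have h2 : a ^ (n + 1) / (a / (a + b)) ^ n + b ^ (n + 1) / (b / (a + b)) ^ n
      = (a + b) ^ (n + 1) := by
    rw [div_pow, div_pow]
    field_simp
    ring
  rw [h1, h2]
  exact pow_le_one₀ hs.le hab


/-- Fix an integer `N ≥ 2`. For all real numbers `I` and `J`, the inequality
`|I|^{1/N} + |J|^{1/N} ≤ 1` holds if and only if at least one of the following holds: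
there exist `q₁,…,q_{N−1} ∈ (0,1)` with
`|I|/(q₁⋯q_{N−1}) + |J|/((1−q₁)⋯(1−q_{N−1})) ≤ 1`; or `J = 0` and `|I| ≤ 1`;
or `I = 0` and `|J| ≤ 1`. -/
theorem nth_root_sum_le_one_iff_quantifier (N : ℕ) (hN : 2 ≤ N) (I J : ℝ) :
    |I| ^ ((1:ℝ)/N) + |J| ^ ((1:ℝ)/N) ≤ 1 ↔
      ((∃ q : Fin (N-1) → ℝ, (∀ j, q j ∈ Set.Ioo (0:ℝ) 1) ∧
          |I| / (∏ j, q j) + |J| / (∏ j, (1 - q j)) ≤ 1)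
        ∨ (J = 0 ∧ |I| ≤ 1) ∨ (I = 0 ∧ |J| ≤ 1)) := by
  obtain ⟨n, rfl⟩ : ∃ n, N = n + 1 := ⟨N - 1, by lia⟩
  have hN0 : (0 : ℝ) < ((n + 1 : ℕ) : ℝ) := by positivity
  have hexp : (0 : ℝ) < 1 / ((n + 1 : ℕ) : ℝ) := by positivity
  have hroot : ∀ x : ℝ, (|x| ^ ((1 : ℝ) / ((n + 1 : ℕ) : ℝ))) ^ (n + 1) = |x| := fun x => by
    rw [one_div, Real.rpow_inv_natCast_pow (abs_nonneg x) n.succ_ne_zero]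
  have hle : ∀ x : ℝ, |x| ^ ((1 : ℝ) / ((n + 1 : ℕ) : ℝ)) ≤ 1 ↔ |x| ≤ 1 := fun x => by
    rw [← pow_le_one_iff_of_nonneg (Real.rpow_nonneg (abs_nonneg x) _) n.succ_ne_zero, hroot]
  rw [Nat.add_sub_cancel]
  constructor
  · intro h
    have hI := Real.rpow_nonneg (abs_nonneg I) ((1 : ℝ) / ((n + 1 : ℕ) : ℝ))
    have hJ := Real.rpow_nonneg (abs_nonneg J) ((1 : ℝ) / ((n + 1 : ℕ) : ℝ))
    by_cases hJ0 : J = 0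
    · exact Or.inr (Or.inl ⟨hJ0, (hle I).1 (by linarith)⟩)
    by_cases hI0 : I = 0
    · exact Or.inr (Or.inr ⟨hI0, (hle J).1 (by linarith)⟩)
    left
    have ha := Real.rpow_pos_of_pos (abs_pos.2 hI0) ((1 : ℝ) / ((n + 1 : ℕ) : ℝ))
    have hb := Real.rpow_pos_of_pos (abs_pos.2 hJ0) ((1 : ℝ) / ((n + 1 : ℕ) : ℝ))
    have key := pow_succ_div_add_pow_succ_div_le_one ha hb h n
    rw [hroot, hroot] at key
    refine ⟨fun _ => _, fun _ => ⟨div_pos ha (add_pos ha hb), ?_⟩, ?_⟩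
    · rw [div_lt_one (add_pos ha hb)]
      linarith
    · simpa only [Finset.prod_const, Finset.card_univ, Fintype.card_fin] using key
  · rintro (⟨q, hq, h⟩ | ⟨rfl, h⟩ | ⟨rfl, h⟩)
    · have hI := rpow_inv_succ_le_of_pos (abs_nonneg I) fun j => (hq j).1
      have hJ := rpow_inv_succ_le_of_pos (abs_nonneg J) fun j => sub_pos.2 (hq j).2
      refine (add_le_add hI hJ).trans ?_
      rw [← add_div, div_le_one hN0, Finset.sum_sub_distrib]
      simp only [Finset.sum_const, Finset.card_univ, Fintype.card_fin, nsmul_eq_mul, mul_one]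
      push_cast
      linarith
    · rw [abs_zero, Real.zero_rpow hexp.ne', add_zero]
      exact (hle I).2 h
    · rw [abs_zero, Real.zero_rpow hexp.ne', zero_add]
      exact (hle J).2 h
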